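/- arXiv:2204.07727 — 3 statements merged into one kernel-verified Lean document; each statement's English description precedes it below -/
import Mathlib

section
/- Let E be a finite-dimensional real inner product space, let β, ρ > 0, and let T be a positive integer. Let f : E → ℝ be a convex, differentiable function. On a probability space, let ν_1, …, ν_T be integrable E-valued random vectors, and define the random iterates θ^(1) = 0 and θ^(t+1) = θ^(t) − η·ν_t with step size η = β/(ρ√T). Assume that for every t, almost surely ‖ν_t‖ ≤ ρ and the conditional expectation of ν_t given ν_1, …, ν_{t−1} equals ∇f(θ^(t)). Let θ̄ = (1/T)·Σ_{t=1}^{T} θ^(t) be the averaged iterate. Then for every θ* ∈ E with ‖θ*‖ ≤ β, E[f(θ̄)] − f(θ*) ≤ βρ/√T. -/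
open MeasureTheory ProbabilityTheory

/-- The first-order condition: a convex function lies above its tangent hyperplanes. -/
theorem ConvexOn.sub_le_inner_gradient
    {E : Type*} [NormedAddCommGroup E] [InnerProductSpace ℝ E] [CompleteSpace E]
    {f : E → ℝ} (hconv : ConvexOn ℝ Set.univ f) {x : E} (hf : DifferentiableAt ℝ f x) (y : E) :
    f x - f y ≤ inner ℝ (gradient f x) (x - y) := by
  have hg : ConvexOn ℝ Set.univ (f ∘ AffineMap.lineMap (k := ℝ) x y) := by
    simpa using hconv.comp_affineMap (AffineMap.lineMap (k := ℝ) x y)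
  have hd : HasDerivAt (f ∘ AffineMap.lineMap (k := ℝ) x y)
      (inner ℝ (gradient f x) (y - x)) 0 := by
    have h : HasFDerivAt f (InnerProductSpace.toDual ℝ E (gradient f x))
        (AffineMap.lineMap (k := ℝ) x y 0) := by
      simpa using hf.hasGradientAt.hasFDerivAt
    simpa using h.comp_hasDerivAt (0 : ℝ) (AffineMap.hasDerivAt_lineMap (a := x) (b := y))
  have h := hg.le_slope_of_hasDerivAt (Set.mem_univ 0) (Set.mem_univ 1) one_pos hd
  simp only [slope_def_field, Function.comp_apply, AffineMap.lineMap_apply_one,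
    AffineMap.lineMap_apply_zero, sub_zero, div_one] at h
  rw [← neg_sub y x, inner_neg_right]
  linarith

/-- The deterministic regret bound for gradient steps with vectors of norm at most `ρ`. -/
theorem two_mul_sum_inner_add_sq_dist_le
    {E : Type*} [NormedAddCommGroup E] [InnerProductSpace ℝ E]
    {η ρ : ℝ} {v x : ℕ → E} (hv : ∀ t, ‖v t‖ ≤ ρ)
    (hx : ∀ t, x (t + 1) = x t - η • v t) (y : E) (n : ℕ) :
    2 * η * ∑ t ∈ Finset.range n, inner ℝ (x t - y) (v t) + ‖x n - y‖ ^ 2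
      ≤ ‖x 0 - y‖ ^ 2 + n * (η * ρ) ^ 2 := by
  induction n with
  | zero => simp
  | succ n ih =>
    have hstep : ‖x (n + 1) - y‖ ^ 2
        = ‖x n - y‖ ^ 2 - 2 * (η * inner ℝ (x n - y) (v n)) + η ^ 2 * ‖v n‖ ^ 2 := by
      rw [hx, sub_right_comm, norm_sub_sq_real, inner_smul_right, norm_smul, mul_pow,
        Real.norm_eq_abs, sq_abs]
    have hsq : η ^ 2 * ‖v n‖ ^ 2 ≤ η ^ 2 * ρ ^ 2 := by
      gcongr
      exact hv n
    rw [Finset.sum_range_succ, hstep]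
    push_cast
    linarith

/-- For a bounded `m`-measurable random vector `X`, pairing with `Y` and pairing with the
conditional expectation of `Y` given `m` have the same mean, and the latter is integrable. -/
theorem integrable_inner_condExp_and_integral_eq
    {E : Type*} [NormedAddCommGroup E] [InnerProductSpace ℝ E] [CompleteSpace E]
    {Ω : Type*} {m m₀ : MeasurableSpace Ω} {μ : Measure Ω} [IsFiniteMeasure μ] (hm : m ≤ m₀)
    {X Y : Ω → E} (hX : StronglyMeasurable[m] X) (hY : Integrable Y μ)
    {c : ℝ} (hc : ∀ᵐ ω ∂μ, ‖X ω‖ ≤ c) :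
    Integrable (fun ω => inner ℝ (X ω) (μ[Y | m] ω)) μ ∧
      ∫ ω, inner ℝ (X ω) (μ[Y | m] ω) ∂μ = ∫ ω, inner ℝ (X ω) (Y ω) ∂μ := by
  have h : μ[fun ω => inner ℝ (X ω) (Y ω) | m] =ᵐ[μ] fun ω => inner ℝ (X ω) (μ[Y | m] ω) :=
    condExp_stronglyMeasurable_bilin_of_bound (innerSL ℝ) hm hX hY c hc
  exact ⟨integrable_condExp.congr h, (integral_congr_ae h).symm.trans (integral_condExp hm)⟩

/-- A continuous function of an almost surely bounded random vector is integrable. -/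
theorem Continuous.integrable_comp_of_ae_norm_le
    {E : Type*} [NormedAddCommGroup E] [ProperSpace E]
    {Ω : Type*} [MeasurableSpace Ω] {μ : Measure Ω} [IsFiniteMeasure μ]
    {f : E → ℝ} (hf : Continuous f) {X : Ω → E} (hX : AEStronglyMeasurable X μ)
    {c : ℝ} (hc : ∀ᵐ ω ∂μ, ‖X ω‖ ≤ c) :
    Integrable (fun ω => f (X ω)) μ := by
  obtain ⟨C, hC⟩ := (isCompact_closedBall (0 : E) c).exists_bound_of_continuousOn hf.continuousOn
  refine Integrable.of_bound (hf.comp_aestronglyMeasurable hX) C ?_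
  filter_upwards [hc] with ω hω
  exact hC _ (by simpa using hω)

/-- Jensen's inequality for the uniform average of finitely many points. -/
theorem ConvexOn.map_inv_smul_sum_le
    {E : Type*} [AddCommGroup E] [Module ℝ E] {f : E → ℝ} (hconv : ConvexOn ℝ Set.univ f)
    {n : ℕ} (hn : 0 < n) (x : ℕ → E) :
    f ((n : ℝ)⁻¹ • ∑ t ∈ Finset.range n, x t) ≤ (n : ℝ)⁻¹ * ∑ t ∈ Finset.range n, f (x t) := by
  have hn' : (n : ℝ) ≠ 0 := by positivity
  rw [Finset.smul_sum, Finset.mul_sum]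
  exact hconv.map_sum_le (fun _ _ => by positivity) (by simp [hn']) (fun _ _ => Set.mem_univ _)

/-- SGD with parameter averaging on a convex Lipschitz function
(Theorem 14.8 of Shalev-Shwartz & Ben-David): with step size `η = β/(ρ√T)`,
conditionally unbiased noisy gradients `ν t` bounded a.s. by `ρ`, and iterates
`θ 1 = 0`, `θ (t+1) = θ t - η • ν t`, the averaged iterate satisfies
`E[f θ̄] - f θ* ≤ βρ/√T` for any `θ*` with `‖θ*‖ ≤ β`. -/
theorem sgd_convergence
    {E : Type*} [NormedAddCommGroup E] [InnerProductSpace ℝ E]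
    [FiniteDimensional ℝ E] [MeasurableSpace E] [BorelSpace E]
    {Ω : Type*} [MeasurableSpace Ω] (μ : Measure Ω) [IsProbabilityMeasure μ]
    (β ρ : ℝ) (hβ : 0 < β) (hρ : 0 < ρ) (T : ℕ) (hT : 0 < T)
    (f : E → ℝ) (hconv : ConvexOn ℝ Set.univ f) (hdiff : Differentiable ℝ f)
    (ν : ℕ → Ω → E) (hmeas : ∀ t, Measurable (ν t)) (hint : ∀ t, Integrable (ν t) μ)
    (hbound : ∀ t, ∀ᵐ ω ∂μ, ‖ν t ω‖ ≤ ρ)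
    (η : ℝ) (hη : η = β / (ρ * Real.sqrt T))
    (θ : ℕ → Ω → E) (hθ1 : θ 1 = fun _ => (0 : E))
    (hθrec : ∀ t, θ (t + 1) = fun ω => θ t ω - η • ν t ω)
    (hgrad : ∀ t,
      μ[ν t | ⨆ s ∈ Finset.Ico 1 t, MeasurableSpace.comap (ν s) inferInstance]
        =ᵐ[μ] fun ω => gradient f (θ t ω))
    (θstar : E) (hθstar : ‖θstar‖ ≤ β) :
    (∫ ω, f ((T : ℝ)⁻¹ • ∑ t ∈ Finset.Icc 1 T, θ t ω) ∂μ) - f θstar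
      ≤ β * ρ / Real.sqrt T := by
  have : ProperSpace E := FiniteDimensional.proper_real E
  have hT' : (0 : ℝ) < T := by exact_mod_cast hT
  have hsqrt : 0 < Real.sqrt T := Real.sqrt_pos.2 hT'
  have hηpos : 0 < η := by rw [hη]; positivity
  have hm : ∀ t, (⨆ s ∈ Finset.Ico 1 t, MeasurableSpace.comap (ν s) inferInstance)
      ≤ (inferInstance : MeasurableSpace Ω) :=
    fun t => iSup₂_le fun s _ => (hmeas s).comap_le
  have hθmeas : ∀ t, Measurable[⨆ s ∈ Finset.Ico 1 (t + 1),
      MeasurableSpace.comap (ν s) inferInstance] (θ (t + 1)) := by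
    intro t
    induction t with
    | zero => rw [zero_add, hθ1]; exact measurable_const
    | succ t ih =>
      rw [hθrec]
      refine (ih.mono (biSup_mono fun s hs => ?_) le_rfl).sub
        (Measurable.const_smul (Measurable.of_comap_le ?_) η)
      · simp only [Finset.mem_Ico] at hs ⊢
        omega
      · exact le_iSup₂_of_le (t + 1) (by simp) le_rfl
  have hθbound : ∀ t, ∃ c, ∀ᵐ ω ∂μ, ‖θ (t + 1) ω‖ ≤ c := by
    intro t
    induction t with
    | zero => exact ⟨0, by simp [hθ1]⟩
    | succ t ih =>
      obtain ⟨c, hc⟩ := ih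
      refine ⟨c + η * ρ, ?_⟩
      filter_upwards [hc, hbound (t + 1)] with ω hω hνω
      rw [hθrec]
      refine (norm_sub_le _ _).trans (add_le_add hω ?_)
      rw [norm_smul, Real.norm_of_nonneg hηpos.le]
      gcongr
  have hθstrong : ∀ t, AEStronglyMeasurable (θ (t + 1)) μ := fun t =>
    ((hθmeas t).mono (hm _) le_rfl).aestronglyMeasurable
  have hfint : ∀ t, Integrable (fun ω => f (θ (t + 1) ω)) μ := fun t =>
    hdiff.continuous.integrable_comp_of_ae_norm_le (hθstrong t) (hθbound t).choose_spec
  have hdiffbound : ∀ t, ∃ c, ∀ᵐ ω ∂μ, ‖θ (t + 1) ω - θstar‖ ≤ c := by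
    intro t
    obtain ⟨c, hc⟩ := hθbound t
    refine ⟨c + ‖θstar‖, ?_⟩
    filter_upwards [hc] with ω hω
    exact (norm_sub_le _ _).trans (by gcongr)
  have hinner : ∀ t, Integrable (fun ω => inner ℝ (θ (t + 1) ω - θstar) (ν (t + 1) ω)) μ := by
    intro t
    obtain ⟨c, hc⟩ := hdiffbound t
    refine Integrable.of_bound (((hθstrong t).sub aestronglyMeasurable_const).inner
      (hmeas _).aestronglyMeasurable) (c * ρ) ?_
    filter_upwards [hc, hbound (t + 1)] with ω hω hνω
    exact (norm_inner_le_norm _ _).trans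
      (mul_le_mul hω hνω (norm_nonneg _) ((norm_nonneg _).trans hω))
  have hstep : ∀ t, ∫ ω, f (θ (t + 1) ω) ∂μ - f θstar
      ≤ ∫ ω, inner ℝ (θ (t + 1) ω - θstar) (ν (t + 1) ω) ∂μ := by
    intro t
    obtain ⟨c, hc⟩ := hdiffbound t
    obtain ⟨hi, he⟩ := integrable_inner_condExp_and_integral_eq (hm (t + 1))
      ((hθmeas t).sub_const θstar).stronglyMeasurable (hint (t + 1)) hc
    have hsub : ∫ ω, f (θ (t + 1) ω) ∂μ - f θstar = ∫ ω, (f (θ (t + 1) ω) - f θstar) ∂μ := by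
      rw [integral_sub (hfint t) (integrable_const _)]
      simp
    rw [hsub, ← he]
    refine integral_mono_ae ((hfint t).sub (integrable_const _)) hi ?_
    filter_upwards [hgrad (t + 1)] with ω hω
    rw [hω, real_inner_comm]
    exact hconv.sub_le_inner_gradient (hdiff _) θstar
  have hregret : ∑ t ∈ Finset.range T, ∫ ω, inner ℝ (θ (t + 1) ω - θstar) (ν (t + 1) ω) ∂μ
      ≤ β * ρ * Real.sqrt T := by
    rw [← integral_finsetSum _ fun t _ => hinner t]
    have hpt : ∀ᵐ ω ∂μ, ∑ t ∈ Finset.range T, inner ℝ (θ (t + 1) ω - θstar) (ν (t + 1) ω)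
        ≤ β * ρ * Real.sqrt T := by
      filter_upwards [ae_all_iff.2 hbound] with ω hω
      have h := two_mul_sum_inner_add_sq_dist_le (η := η) (v := fun t => ν (t + 1) ω)
        (x := fun t => θ (t + 1) ω) (fun t => hω (t + 1))
        (fun t => congrFun (hθrec (t + 1)) ω) θstar T
      have h0 : ‖θ (0 + 1) ω - θstar‖ ^ 2 ≤ β ^ 2 := by
        rw [zero_add, hθ1, zero_sub, norm_neg]
        gcongr
      have hTη : T * (η * ρ) ^ 2 = β ^ 2 := by
        rw [hη]
        field_simp
        rw [Real.sq_sqrt hT'.le]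
      have hηβ : η * (β * ρ * Real.sqrt T) = β ^ 2 := by
        rw [hη]
        field_simp
      refine le_of_mul_le_mul_left ?_ hηpos
      nlinarith [sq_nonneg ‖θ (T + 1) ω - θstar‖]
    calc _ ≤ ∫ _, β * ρ * Real.sqrt T ∂μ :=
          integral_mono_ae (integrable_finsetSum _ fun t _ => hinner t) (integrable_const _) hpt
      _ = β * ρ * Real.sqrt T := by simp
  have hIcc : ∀ ω, ∑ t ∈ Finset.Icc 1 T, θ t ω = ∑ t ∈ Finset.range T, θ (t + 1) ω := by
    intro ω
    rw [Finset.range_eq_Ico, Finset.sum_Ico_add' (fun t => θ t ω) 0 T 1]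
    rfl
  have hjensen : ∫ ω, f ((T : ℝ)⁻¹ • ∑ t ∈ Finset.Icc 1 T, θ t ω) ∂μ
      ≤ (T : ℝ)⁻¹ * ∑ t ∈ Finset.range T, ∫ ω, f (θ (t + 1) ω) ∂μ := by
    rw [← integral_finsetSum _ fun t _ => hfint t, ← integral_const_mul]
    refine integral_mono_ae ?_ ((integrable_finsetSum _ fun t _ => hfint t).const_mul _)
      (.of_forall fun ω => ?_)
    · choose c hc using hθbound
      refine hdiff.continuous.integrable_comp_of_ae_norm_le
        (c := (T : ℝ)⁻¹ * ∑ t ∈ Finset.range T, c t) ?_ ?_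
      · simp_rw [hIcc]
        exact (Finset.aestronglyMeasurable_fun_sum _ fun t _ => hθstrong t).const_smul _
      · filter_upwards [ae_all_iff.2 hc] with ω hω
        rw [hIcc, norm_smul, Real.norm_of_nonneg (by positivity)]
        gcongr
        exact norm_sum_le_of_le _ fun t _ => hω t
    · simp only [hIcc]
      exact hconv.map_inv_smul_sum_le hT fun t => θ (t + 1) ω
  have hsum : ∑ t ∈ Finset.range T, ∫ ω, f (θ (t + 1) ω) ∂μ
      ≤ β * ρ * Real.sqrt T + T * f θstar := by
    have h := Finset.sum_le_sum fun t (_ : t ∈ Finset.range T) => hstep t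
    rw [Finset.sum_sub_distrib, Finset.sum_const, Finset.card_range, nsmul_eq_mul] at h
    linarith
  calc (∫ ω, f ((T : ℝ)⁻¹ • ∑ t ∈ Finset.Icc 1 T, θ t ω) ∂μ) - f θstar
      ≤ (T : ℝ)⁻¹ * (β * ρ * Real.sqrt T + T * f θstar) - f θstar := by
        gcongr
        exact hjensen.trans (by gcongr)
    _ = β * ρ / Real.sqrt T := by
        field_simp
        linear_combination β * ρ * Real.sq_sqrt hT'.le
end

section
/- Let ι be a finite index set of tree nodes, let λ ≥ 1, B > 0, let q be a positive integer with q ≤ 4, let r be a natural number, and let lev : ι → ℕ be a level function with lev(j) ≤ r for all j ∈ ι. Let u : ι → ℝ^d. Assume: (i) for every i ∈ {0,…,r}, the number of nodes j with lev(j) = i is at most q^i; and (ii) ‖u_j‖ ≤ λ·B/2^{lev(j)} for every j ∈ ι. Then Σ_{j∈ι} ‖u_j‖² ≤ (r+1)·λ²·B². Consequently, if in addition r + 1 ≤ (log₂ k)/2 for some k > 1, then √(Σ_{j∈ι} ‖u_j‖²) ≤ (1/√2)·λ·B·√(log₂ k). -/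
/-- The `c ≤ 1` case of Lemma 3 of the paper: when the tree fanout satisfies
`q ≤ 4`, level `i` contains at most `q^i` nodes, and each node `j` satisfies
`‖u_j‖ ≤ λB/2^{lev j}`, then `∑_j ‖u_j‖² ≤ (r+1)λ²B²`; consequently, if moreover
`r + 1 ≤ (log₂ k)/2` for some `k > 1`, then
`√(∑_j ‖u_j‖²) ≤ (1/√2)·λ·B·√(log₂ k)`. -/
theorem covertree_norm_small_dimension {ι : Type*} [Fintype ι] (d : ℕ)
    (lam B : ℝ) (hlam : 1 ≤ lam) (hB : 0 < B)
    (q : ℕ) (hq : 0 < q) (hq4 : q ≤ 4) (r : ℕ)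
    (lev : ι → ℕ) (hlev : ∀ j, lev j ≤ r)
    (u : ι → EuclideanSpace ℝ (Fin d))
    (hcard : ∀ i ≤ r, (Finset.univ.filter fun j => lev j = i).card ≤ q ^ i)
    (hu : ∀ j, ‖u j‖ ≤ lam * B / 2 ^ lev j) :
    (∑ j, ‖u j‖ ^ 2 ≤ (r + 1 : ℝ) * lam ^ 2 * B ^ 2)
    ∧ (∀ k : ℝ, 1 < k → (r : ℝ) + 1 ≤ Real.logb 2 k / 2 →
        Real.sqrt (∑ j, ‖u j‖ ^ 2)
          ≤ (1 / Real.sqrt 2) * lam * B * Real.sqrt (Real.logb 2 k)) := by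
  have level_bound : ∀ i ∈ Finset.range (r + 1),
      ∑ j with lev j = i, ‖u j‖ ^ 2 ≤ lam ^ 2 * B ^ 2 := by
    intro i hi
    have hcard4 : ((Finset.univ.filter fun j => lev j = i).card : ℝ) ≤ 4 ^ i := by
      exact_mod_cast (hcard i (Finset.mem_range_succ_iff.mp hi)).trans (Nat.pow_le_pow_left hq4 i)
    calc ∑ j with lev j = i, ‖u j‖ ^ 2
        ≤ ∑ j with lev j = i, (lam * B / 2 ^ i) ^ 2 := by
          refine Finset.sum_le_sum fun j hj => ?_
          have hj' : lev j = i := (Finset.mem_filter.mp hj).2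
          exact pow_le_pow_left₀ (norm_nonneg _) (hj' ▸ hu j) 2
      _ = ((Finset.univ.filter fun j => lev j = i).card : ℝ) * (lam * B / 2 ^ i) ^ 2 := by
          rw [Finset.sum_const, nsmul_eq_mul]
      _ ≤ 4 ^ i * (lam * B / 2 ^ i) ^ 2 := by gcongr
      _ = lam ^ 2 * B ^ 2 := by
          have h4 : (4 : ℝ) ^ i = (2 ^ i) ^ 2 := by
            rw [← pow_mul, mul_comm, pow_mul]; norm_num
          rw [h4]
          field_simp
  have sum_bound : ∑ j, ‖u j‖ ^ 2 ≤ (r + 1 : ℝ) * lam ^ 2 * B ^ 2 := by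
    rw [← Finset.sum_fiberwise_of_maps_to (s := Finset.univ) (t := Finset.range (r + 1)) (g := lev)
      fun j _ => Finset.mem_range_succ_iff.mpr (hlev j)]
    refine (Finset.sum_le_sum level_bound).trans_eq ?_
    simp [mul_assoc]
  refine ⟨sum_bound, fun k hk hr => ?_⟩
  have hlog : 0 ≤ Real.logb 2 k := (Real.logb_pos one_lt_two hk).le
  refine Real.sqrt_le_iff.mpr ⟨by positivity, sum_bound.trans ?_⟩
  calc (r + 1 : ℝ) * lam ^ 2 * B ^ 2 ≤ Real.logb 2 k / 2 * lam ^ 2 * B ^ 2 := by gcongr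
    _ = ((1 / Real.sqrt 2) * lam * B * Real.sqrt (Real.logb 2 k)) ^ 2 := by
        rw [mul_pow, mul_pow, mul_pow, div_pow, Real.sq_sqrt hlog, Real.sq_sqrt zero_le_two]
        ring
end

section
/- Let ι be a finite index set of tree nodes, let λ ≥ 1, B > 0, let q be an integer with q ≥ 5, let r be a natural number, set k = q^r and c = log₄ q, and let lev : ι → ℕ be a level function with lev(j) ≤ r for all j ∈ ι. Let u : ι → ℝ^d. Assume: (i) for every i ∈ {0,…,r}, the number of nodes j with lev(j) = i is at most q^i; and (ii) ‖u_j‖ ≤ λ·B/2^{lev(j)} for every j ∈ ι. Then Σ_{j∈ι} ‖u_j‖² ≤ 5·λ²·B²·k^{1−1/c}, and hence √(Σ_{j∈ι} ‖u_j‖²) ≤ √5·λ·B·√(k^{1−1/c}). -/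
/-- A geometric sum with ratio at least `5 / 4` is at most five times its last term. -/
lemma geom_sum_le_five_mul_pow {x : ℝ} (hx : 5 / 4 ≤ x) (r : ℕ) :
    ∑ i ∈ Finset.range (r + 1), x ^ i ≤ 5 * x ^ r := by
  induction r with
  | zero => norm_num
  | succ n ih =>
    rw [Finset.sum_range_succ, pow_succ]
    have hpow : 0 ≤ x ^ n := by positivity
    nlinarith [mul_nonneg hpow (sub_nonneg.mpr hx)]

lemma pow_rpow_one_sub_inv_logb {a b : ℝ} (ha : 0 < a) (ha1 : a ≠ 1) (hb : 0 < b) (r : ℕ) :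
    (a ^ r) ^ (1 - 1 / Real.logb b a) = (a / b) ^ r := by
  rw [← Real.rpow_natCast a, ← Real.rpow_mul ha.le, mul_comm, Real.rpow_mul ha.le,
    Real.rpow_natCast, Real.rpow_sub ha, Real.rpow_one, one_div, Real.inv_logb,
    Real.rpow_logb ha ha1 hb]

/-- A sum over nodes whose terms are bounded level by level is at most the sum over levels of
the bounds, weighted by bounds on the level sizes. -/
lemma sum_le_sum_range_level {ι : Type*} [Fintype ι] {lev : ι → ℕ} {r : ℕ}
    (hlev : ∀ j, lev j ≤ r) {n : ℕ → ℕ}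
    (hcard : ∀ i ≤ r, (Finset.univ.filter fun j => lev j = i).card ≤ n i)
    {f : ι → ℝ} {g : ℕ → ℝ} (hg : ∀ i, 0 ≤ g i) (hf : ∀ j, f j ≤ g (lev j)) :
    ∑ j, f j ≤ ∑ i ∈ Finset.range (r + 1), n i * g i := by
  have hmaps : ∀ j ∈ Finset.univ, lev j ∈ Finset.range (r + 1) := fun j _ =>
    Finset.mem_range_succ_iff.mpr (hlev j)
  rw [← Finset.sum_fiberwise_of_maps_to hmaps]
  refine Finset.sum_le_sum fun i hi => ?_
  calc ∑ j with lev j = i, f j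
      ≤ (Finset.univ.filter fun j => lev j = i).card • g i :=
        Finset.sum_le_card_nsmul _ _ _ fun j hj => (Finset.mem_filter.mp hj).2 ▸ hf j
    _ ≤ n i * g i := by
        rw [nsmul_eq_mul]
        exact mul_le_mul_of_nonneg_right
          (mod_cast hcard i (Finset.mem_range_succ_iff.mp hi)) (hg i)

/-- The `c > 1` case of Lemma 3 of the paper: when the tree fanout satisfies
`q ≥ 5`, there are `k = q^r` labels, and `c = log₄ q`, the bounds
`∑_j ‖u_j‖² ≤ 5λ²B²·k^{1−1/c}` and `√(∑_j ‖u_j‖²) ≤ √5·λ·B·√(k^{1−1/c})` hold. -/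
theorem covertree_norm_large_dimension {ι : Type*} [Fintype ι] (d : ℕ)
    (lam B : ℝ) (hlam : 1 ≤ lam) (hB : 0 < B)
    (q : ℕ) (hq : 5 ≤ q) (r : ℕ)
    (k c : ℝ) (hk : k = (q : ℝ) ^ r) (hc : c = Real.logb 4 q)
    (lev : ι → ℕ) (hlev : ∀ j, lev j ≤ r)
    (u : ι → EuclideanSpace ℝ (Fin d))
    (hcard : ∀ i ≤ r, (Finset.univ.filter fun j => lev j = i).card ≤ q ^ i)
    (hu : ∀ j, ‖u j‖ ≤ lam * B / 2 ^ lev j) :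
    (∑ j, ‖u j‖ ^ 2 ≤ 5 * lam ^ 2 * B ^ 2 * k ^ (1 - 1 / c))
    ∧ Real.sqrt (∑ j, ‖u j‖ ^ 2)
        ≤ Real.sqrt 5 * lam * B * Real.sqrt (k ^ (1 - 1 / c)) := by
  have hq' : (5 : ℝ) ≤ q := mod_cast hq
  have hsum : ∑ j, ‖u j‖ ^ 2 ≤ 5 * lam ^ 2 * B ^ 2 * k ^ (1 - 1 / c) := by
    rw [hk, hc, pow_rpow_one_sub_inv_logb (by linarith) (by linarith) four_pos]
    calc ∑ j, ‖u j‖ ^ 2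
        ≤ ∑ i ∈ Finset.range (r + 1), ((q ^ i : ℕ) : ℝ) * (lam * B / 2 ^ i) ^ 2 :=
          sum_le_sum_range_level hlev hcard (fun i => sq_nonneg _)
            fun j => pow_le_pow_left₀ (norm_nonneg _) (hu j) 2
      _ = lam ^ 2 * B ^ 2 * ∑ i ∈ Finset.range (r + 1), ((q : ℝ) / 4) ^ i := by
          rw [Finset.mul_sum]
          refine Finset.sum_congr rfl fun i _ => ?_
          rw [div_pow, div_pow, ← pow_mul, mul_comm i 2, pow_mul]
          push_cast
          norm_num
          ring
      _ ≤ lam ^ 2 * B ^ 2 * (5 * ((q : ℝ) / 4) ^ r) := by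
          gcongr
          exact geom_sum_le_five_mul_pow (by linarith) r
      _ = 5 * lam ^ 2 * B ^ 2 * ((q : ℝ) / 4) ^ r := by ring
  refine ⟨hsum, (Real.sqrt_le_sqrt hsum).trans_eq ?_⟩
  rw [Real.sqrt_mul (by positivity), Real.sqrt_mul (by positivity), Real.sqrt_mul (by positivity),
    Real.sqrt_sq (by linarith), Real.sqrt_sq hB.le]
end
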